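/- Let λ* ∈ Δ(X) achieve the channel capacity C, with Q* = λ*Φ and Q*_j > 0 for all j. Write D*_i = D(P^i‖Q*), D*_{i',i} = −Σ_j P^{i'}_j P^i_j / Q*_j, and D*_{i,i',i''} = ∂²D_i/∂λ_{i'}∂λ_{i''}(λ*), where D_i(λ) = D(P^i‖λΦ). Then for all i, i', i'' ∈ {1,…,m}: ∂²F_i/∂λ_{i'}∂λ_{i''}(λ*) = e^{D*_i − C} [ (1 − e^{D*_{i'} − C} + D*_{i,i'})(δ_{ii''} + λ*_i(1 − e^{D*_{i''} − C})) + (1 − e^{D*_{i''} − C} + D*_{i,i''})(δ_{ii'} + λ*_i(1 − e^{D*_{i'} − C})) + λ*_i ( D*_{i,i'} D*_{i,i''} + D*_{i,i',i''} + D*_{i',i''} − e^{D*_{i'} − C} D*_{i',i''} − e^{D*_{i''} − C} D*_{i',i''} − Σ_{k : λ*_k > 0} λ*_k D*_{k,i'} D*_{k,i''} ) ]. (Theorem 6, general formula) -/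

import Mathlib

open scoped BigOperators

noncomputable section

/-- The simplex of probability vectors on `Fin m`. -/
def chSimplex (m : ℕ) : Set (Fin m → ℝ) :=
  {l | (∀ i, 0 ≤ l i) ∧ ∑ i, l i = 1}

/-- The output distribution `λΦ` of the channel `P` for input distribution `l`. -/
def chOut {m n : ℕ} (P : Matrix (Fin m) (Fin n) ℝ) (l : Fin m → ℝ) (j : Fin n) : ℝ :=
  ∑ i, l i * P i j

/-- Kullback-Leibler divergence `D(Q‖Q')`. -/
def chKL {n : ℕ} (Q Q' : Fin n → ℝ) : ℝ :=
  ∑ j, Q j * Real.log (Q j / Q' j)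

/-- Mutual information `I(λ,Φ)`. -/
def chMI {m n : ℕ} (P : Matrix (Fin m) (Fin n) ℝ) (l : Fin m → ℝ) : ℝ :=
  ∑ i, ∑ j, l i * P i j * Real.log (P i j / chOut P l j)

/-- The Arimoto map `F(λ)`, componentwise. -/
def chAF {m n : ℕ} (P : Matrix (Fin m) (Fin n) ℝ) (l : Fin m → ℝ) (i : Fin m) : ℝ :=
  l i * Real.exp (chKL (P i) (chOut P l)) /
    ∑ k, l k * Real.exp (chKL (P k) (chOut P l))

/-- Partial derivative `∂f/∂λ_{i'}` at `x`, treating the coordinates as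
independent variables. -/
def chPd {m : ℕ} (f : (Fin m → ℝ) → ℝ) (i' : Fin m) (x : Fin m → ℝ) : ℝ :=
  fderiv ℝ f x (Pi.single i' 1)

/-- Second partial derivative `∂²f/∂λ_{i'}∂λ_{i''}` at `x`. -/
def chPd2 {m : ℕ} (f : (Fin m → ℝ) → ℝ) (i' i'' : Fin m) (x : Fin m → ℝ) : ℝ :=
  chPd (chPd f i'') i' x

/-- `f` is Fréchet differentiable at `x` and its derivative in direction `v` is `d`. -/
def HasDirDeriv {m : ℕ} (f : (Fin m → ℝ) → ℝ) (d : ℝ) (v x : Fin m → ℝ) : Prop :=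
  ∃ f' : (Fin m → ℝ) →L[ℝ] ℝ, HasFDerivAt f f' x ∧ f' v = d

namespace HasDirDeriv

variable {m : ℕ} {f g : (Fin m → ℝ) → ℝ} {d e : ℝ} {v x : Fin m → ℝ}

theorem chPd_eq {a : Fin m} (h : HasDirDeriv f d (Pi.single a 1) x) : chPd f a x = d := by
  obtain ⟨f', hf, rfl⟩ := h
  rw [chPd, hf.fderiv]

theorem continuousAt (h : HasDirDeriv f d v x) : ContinuousAt f x := by
  obtain ⟨f', hf, -⟩ := h
  exact hf.continuousAt

theorem const (c : ℝ) (v x : Fin m → ℝ) : HasDirDeriv (fun _ => c) 0 v x :=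
  ⟨0, hasFDerivAt_const c x, rfl⟩

theorem coord (k : Fin m) (v x : Fin m → ℝ) : HasDirDeriv (fun y => y k) (v k) v x :=
  ⟨ContinuousLinearMap.proj k, hasFDerivAt_apply k x, rfl⟩

theorem add (hf : HasDirDeriv f d v x) (hg : HasDirDeriv g e v x) :
    HasDirDeriv (fun y => f y + g y) (d + e) v x := by
  obtain ⟨f', hf, rfl⟩ := hf
  obtain ⟨g', hg, rfl⟩ := hg
  exact ⟨f' + g', hf.add hg, rfl⟩

theorem sub (hf : HasDirDeriv f d v x) (hg : HasDirDeriv g e v x) :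
    HasDirDeriv (fun y => f y - g y) (d - e) v x := by
  obtain ⟨f', hf, rfl⟩ := hf
  obtain ⟨g', hg, rfl⟩ := hg
  exact ⟨f' - g', hf.sub hg, rfl⟩

theorem mul (hf : HasDirDeriv f d v x) (hg : HasDirDeriv g e v x) :
    HasDirDeriv (fun y => f y * g y) (d * g x + f x * e) v x := by
  obtain ⟨f', hf, rfl⟩ := hf
  obtain ⟨g', hg, rfl⟩ := hg
  refine ⟨_, hf.mul hg, ?_⟩
  simp
  ring

theorem comp_hasDerivAt {φ : ℝ → ℝ} {φ' : ℝ} (hφ : HasDerivAt φ φ' (f x))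
    (hf : HasDirDeriv f d v x) : HasDirDeriv (fun y => φ (f y)) (φ' * d) v x := by
  obtain ⟨f', hf, rfl⟩ := hf
  exact ⟨_, hφ.comp_hasFDerivAt x hf, rfl⟩

theorem div (hf : HasDirDeriv f d v x) (hg : HasDirDeriv g e v x) (h0 : g x ≠ 0) :
    HasDirDeriv (fun y => f y / g y) ((d * g x - f x * e) / g x ^ 2) v x := by
  have h := hf.mul (comp_hasDerivAt (hasDerivAt_inv h0) hg)
  simp only [← div_eq_mul_inv] at h
  convert h using 1
  field_simp
  ring

theorem exp (hf : HasDirDeriv f d v x) :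
    HasDirDeriv (fun y => Real.exp (f y)) (Real.exp (f x) * d) v x :=
  comp_hasDerivAt (Real.hasDerivAt_exp _) hf

theorem log (hf : HasDirDeriv f d v x) (h0 : f x ≠ 0) :
    HasDirDeriv (fun y => Real.log (f y)) ((f x)⁻¹ * d) v x :=
  comp_hasDerivAt (Real.hasDerivAt_log h0) hf

theorem sum {ι : Type*} [Fintype ι] {f : ι → (Fin m → ℝ) → ℝ} {d : ι → ℝ}
    (h : ∀ k, HasDirDeriv (f k) (d k) v x) :
    HasDirDeriv (fun y => ∑ k, f k y) (∑ k, d k) v x := by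
  choose f' hf hd using h
  refine ⟨∑ k, f' k, HasFDerivAt.fun_sum fun k _ => hf k, ?_⟩
  simp [hd]

/-- Fermat's rule along a line. -/
theorem eq_zero_of_isLocalMax (hf : HasDirDeriv f d v x)
    (h : IsLocalMax (fun t : ℝ => f (x + t • v)) 0) : d = 0 := by
  obtain ⟨f', hf, rfl⟩ := hf
  have h2 : HasDerivAt (fun t : ℝ => x + t • v) v 0 := by
    simpa using ((hasDerivAt_id (0 : ℝ)).smul_const v).const_add x
  have h1 : HasFDerivAt f f' (x + (0 : ℝ) • v) := by simpa using hf
  exact h.hasDerivAt_eq_zero (h1.comp_hasDerivAt (0 : ℝ) h2)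

end HasDirDeriv

theorem chPd_congr {m : ℕ} {f g : (Fin m → ℝ) → ℝ} {x : Fin m → ℝ} (a : Fin m)
    (h : ∀ᶠ y in nhds x, f y = g y) : chPd f a x = chPd g a x := by
  rw [chPd, chPd, Filter.EventuallyEq.fderiv_eq h]

section Channel

variable {m n : ℕ} (P : Matrix (Fin m) (Fin n) ℝ)

theorem chOut_single (a : Fin m) (j : Fin n) : chOut P (Pi.single a 1) j = P a j := by
  simp [chOut, Pi.single_apply]

theorem hasDirDeriv_chOut (j : Fin n) (v x : Fin m → ℝ) :
    HasDirDeriv (fun y => chOut P y j) (chOut P v j) v x := by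
  have h := HasDirDeriv.sum fun k =>
    (HasDirDeriv.coord k v x).mul (HasDirDeriv.const (P k j) v x)
  simpa [chOut] using h

theorem eventually_chOut_pos {x : Fin m → ℝ} (hx : ∀ j, 0 < chOut P x j) :
    ∀ᶠ y in nhds x, ∀ j, 0 < chOut P y j :=
  Filter.eventually_all.2 fun j =>
    (hasDirDeriv_chOut P j 0 x).continuousAt.eventually_const_lt (hx j)

theorem hasDirDeriv_chKL (k : Fin m) (v : Fin m → ℝ) {x : Fin m → ℝ}
    (hx : ∀ j, 0 < chOut P x j) :
    HasDirDeriv (fun y => chKL (P k) (chOut P y))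
      (-∑ j, P k j * chOut P v j / chOut P x j) v x := by
  rw [← Finset.sum_neg_distrib]
  refine HasDirDeriv.sum fun j => ?_
  have hQ := (hx j).ne'
  by_cases h0 : P k j = 0
  · simpa [h0] using HasDirDeriv.const 0 v x
  · have h := (HasDirDeriv.const (P k j) v x).mul
      (((HasDirDeriv.const (P k j) v x).div (hasDirDeriv_chOut P j v x) hQ).log
        (div_ne_zero h0 hQ))
    convert h using 1
    field_simp
    ring

/-- The partial derivative of `D(P^k‖λΦ)` with respect to `λ_a`. -/
def chKLd (k a : Fin m) (x : Fin m → ℝ) : ℝ := -∑ j, P k j * P a j / chOut P x j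

/-- The second partial derivative of `D(P^k‖λΦ)` with respect to `λ_a` and `λ_b`. -/
def chKLdd (k a b : Fin m) (x : Fin m → ℝ) : ℝ :=
  ∑ j, P k j * P a j * P b j / chOut P x j ^ 2

theorem hasDirDeriv_chKL_single (k a : Fin m) {x : Fin m → ℝ}
    (hx : ∀ j, 0 < chOut P x j) :
    HasDirDeriv (fun y => chKL (P k) (chOut P y)) (chKLd P k a x) (Pi.single a 1) x := by
  simpa only [chKLd, chOut_single] using hasDirDeriv_chKL P k (Pi.single a 1) hx

theorem hasDirDeriv_chKLd (k b a : Fin m) {x : Fin m → ℝ} (hx : ∀ j, 0 < chOut P x j) :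
    HasDirDeriv (chKLd P k b) (chKLdd P k a b x) (Pi.single a 1) x := by
  have h := HasDirDeriv.sum fun j =>
    (HasDirDeriv.const (-(P k j * P b j)) (Pi.single a 1) x).div
      (hasDirDeriv_chOut P j (Pi.single a 1) x) (hx j).ne'
  simp only [chOut_single] at h
  convert h using 1
  · ext y
    simp [chKLd, neg_div]
  · refine Finset.sum_congr rfl fun j _ => ?_
    ring

theorem chPd2_chKL (k a b : Fin m) {x : Fin m → ℝ} (hx : ∀ j, 0 < chOut P x j) :
    chPd2 (fun y => chKL (P k) (chOut P y)) a b x = chKLdd P k a b x := by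
  rw [chPd2, chPd_congr a (g := chKLd P k b), (hasDirDeriv_chKLd P k b a hx).chPd_eq]
  filter_upwards [eventually_chOut_pos P hx] with y hy
  exact (hasDirDeriv_chKL_single P k b hy).chPd_eq

theorem chKLd_comm (k a : Fin m) (x : Fin m → ℝ) : chKLd P k a x = chKLd P a k x := by
  simp only [chKLd, mul_comm]

theorem sum_mul_mul_chOut (x : Fin m → ℝ) (c : Fin n → ℝ) :
    ∑ k, x k * ∑ j, P k j * c j = ∑ j, chOut P x j * c j := by
  simp only [chOut, Finset.mul_sum, Finset.sum_mul]
  rw [Finset.sum_comm]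
  exact Finset.sum_congr rfl fun j _ => Finset.sum_congr rfl fun k _ => by ring

theorem sum_mul_chKL_deriv (v : Fin m → ℝ) {x : Fin m → ℝ} (hx : ∀ j, 0 < chOut P x j) :
    ∑ k, x k * (-∑ j, P k j * chOut P v j / chOut P x j) = -∑ j, chOut P v j := by
  simp only [mul_neg, Finset.sum_neg_distrib, mul_div_assoc]
  rw [sum_mul_mul_chOut]
  congr 1
  exact Finset.sum_congr rfl fun j _ => mul_div_cancel₀ _ (hx j).ne'

theorem sum_mul_chKLd (hrow : ∀ i, ∑ j, P i j = 1) (a : Fin m) {x : Fin m → ℝ}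
    (hx : ∀ j, 0 < chOut P x j) : ∑ k, x k * chKLd P k a x = -1 := by
  simpa only [chKLd, chOut_single, hrow] using sum_mul_chKL_deriv P (Pi.single a 1) hx

theorem sum_mul_chKLdd (a b : Fin m) {x : Fin m → ℝ} (hx : ∀ j, 0 < chOut P x j) :
    ∑ k, x k * chKLdd P k a b x = -chKLd P a b x := by
  simp only [chKLdd, chKLd, mul_assoc, mul_div_assoc, neg_neg]
  rw [sum_mul_mul_chOut]
  refine Finset.sum_congr rfl fun j _ => ?_
  have := (hx j).ne'
  field_simp

theorem chMI_eq (x : Fin m → ℝ) : chMI P x = ∑ k, x k * chKL (P k) (chOut P x) := by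
  simp only [chMI, chKL, Finset.mul_sum, mul_assoc]

theorem sum_chOut (hrow : ∀ i, ∑ j, P i j = 1) (v : Fin m → ℝ) :
    ∑ j, chOut P v j = ∑ k, v k := by
  simp only [chOut]
  rw [Finset.sum_comm]
  simp [← Finset.mul_sum, hrow]

/-- The Kuhn–Tucker condition on the support of a capacity-achieving distribution. -/
theorem chKL_eq_capacity (hrow : ∀ i, ∑ j, P i j = 1) {C : ℝ}
    (hub : ∀ l ∈ chSimplex m, chMI P l ≤ C) {x : Fin m → ℝ} (hx : x ∈ chSimplex m)
    (hach : chMI P x = C) (hpos : ∀ j, 0 < chOut P x j) {i : Fin m} (hi : 0 < x i) :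
    chKL (P i) (chOut P x) = C := by
  set v : Fin m → ℝ := Pi.single i 1 - x with hv
  have hvsum : ∑ k, v k = 0 := by simp [hv, hx.2]
  have hder := HasDirDeriv.sum fun k =>
    (HasDirDeriv.coord k v x).mul (hasDirDeriv_chKL P k v hpos)
  rw [Finset.sum_add_distrib, sum_mul_chKL_deriv P v hpos, sum_chOut P hrow, hvsum] at hder
  simp only [← chMI_eq] at hder
  have hmax : IsLocalMax (fun t : ℝ => chMI P (x + t • v)) 0 := by
    have h1 : ∀ᶠ t : ℝ in nhds 0, t < 1 := Iio_mem_nhds one_pos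
    have h2 : ∀ᶠ t : ℝ in nhds 0, 0 < x i + t * (1 - x i) := by
      have hc : ContinuousAt (fun t : ℝ => x i + t * (1 - x i)) 0 := by fun_prop
      exact hc.eventually_const_lt (by simpa using hi)
    filter_upwards [h1, h2] with t ht1 ht2
    simp only [zero_smul, add_zero, hach]
    refine hub _ ⟨fun k => ?_, ?_⟩
    · by_cases hk : k = i
      · subst hk
        simpa [hv] using ht2.le
      · have := mul_nonneg (sub_nonneg.2 ht1.le) (hx.1 k)
        simp only [hv, Pi.add_apply, Pi.smul_apply, Pi.sub_apply, Pi.single_eq_of_ne hk,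
          smul_eq_mul]
        linarith
    · simp [Finset.sum_add_distrib, ← Finset.mul_sum, hvsum, hx.2]
  have h0 := hder.eq_zero_of_isLocalMax hmax
  simp only [hv, Pi.sub_apply, sub_mul, Finset.sum_sub_distrib, ← chMI_eq, hach,
    Pi.single_apply, ite_mul, one_mul, zero_mul, Finset.sum_ite_eq', Finset.mem_univ,
    if_true] at h0
  linarith

/-- The unnormalised Arimoto weight `λ_k exp(D(P^k‖λΦ))`. -/
def chW (k : Fin m) (x : Fin m → ℝ) : ℝ := x k * Real.exp (chKL (P k) (chOut P x))

/-- The partial derivative of `chW P k` with respect to `λ_a`. -/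
def chWd (k a : Fin m) (x : Fin m → ℝ) : ℝ :=
  ((if k = a then 1 else 0) + x k * chKLd P k a x) * Real.exp (chKL (P k) (chOut P x))

/-- The second partial derivative of `chW P k` with respect to `λ_a` and `λ_b`. -/
def chWdd (k a b : Fin m) (x : Fin m → ℝ) : ℝ :=
  ((if k = a then chKLd P k b x else 0) + (if k = b then chKLd P k a x else 0)
    + x k * (chKLd P k a x * chKLd P k b x + chKLdd P k a b x))
    * Real.exp (chKL (P k) (chOut P x))

theorem hasDirDeriv_chW (k a : Fin m) {x : Fin m → ℝ} (hx : ∀ j, 0 < chOut P x j) :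
    HasDirDeriv (chW P k) (chWd P k a x) (Pi.single a 1) x := by
  convert (HasDirDeriv.coord k (Pi.single a 1) x).mul
    (hasDirDeriv_chKL_single P k a hx).exp using 1
  · rfl
  · simp only [chWd, Pi.single_apply]
    ring

theorem hasDirDeriv_chWd (k b a : Fin m) {x : Fin m → ℝ} (hx : ∀ j, 0 < chOut P x j) :
    HasDirDeriv (chWd P k b) (chWdd P k a b x) (Pi.single a 1) x := by
  convert ((HasDirDeriv.const (if k = b then 1 else 0) (Pi.single a 1) x).add
    ((HasDirDeriv.coord k (Pi.single a 1) x).mul (hasDirDeriv_chKLd P k b a hx))).mul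
    (hasDirDeriv_chKL_single P k a hx).exp using 1
  · rfl
  · simp only [chWdd, Pi.single_apply]
    split_ifs <;> ring

theorem chPd2_chAF (i a b : Fin m) {x : Fin m → ℝ} (hx : ∀ j, 0 < chOut P x j)
    (hZ : ∑ k, chW P k x ≠ 0) :
    chPd2 (fun y => chAF P y i) a b x
      = (((chWdd P i a b x * ∑ k, chW P k x) + chWd P i b x * ∑ k, chWd P k a x
            - (chWd P i a x * (∑ k, chWd P k b x) + chW P i x * ∑ k, chWdd P k a b x))
            * (∑ k, chW P k x) ^ 2
          - (chWd P i b x * (∑ k, chW P k x) - chW P i x * ∑ k, chWd P k b x)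
            * (2 * (∑ k, chW P k x) * ∑ k, chWd P k a x))
        / ((∑ k, chW P k x) ^ 2) ^ 2 := by
  have hZd := fun c (y : Fin m → ℝ) (hy : ∀ j, 0 < chOut P y j) =>
    HasDirDeriv.sum fun k => hasDirDeriv_chW P k c hy
  have hZdd := HasDirDeriv.sum fun k => hasDirDeriv_chWd P k b a hx
  rw [chPd2, chPd_congr a (g := fun y =>
    (chWd P i b y * (∑ k, chW P k y) - chW P i y * ∑ k, chWd P k b y)
      / ((∑ k, chW P k y) * ∑ k, chW P k y))]
  · refine HasDirDeriv.chPd_eq ?_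
    convert ((((hasDirDeriv_chWd P i b a hx).mul (hZd a x hx)).sub
      ((hasDirDeriv_chW P i a hx).mul hZdd)).div ((hZd a x hx).mul (hZd a x hx))
        (mul_ne_zero hZ hZ)) using 1
    ring
  · filter_upwards [eventually_chOut_pos P hx,
      (hZd a x hx).continuousAt.eventually_ne hZ] with y hy hyZ
    rw [← sq]
    exact ((hasDirDeriv_chW P i b hy).div (hZd b y hy) hyZ).chPd_eq

end Channel

/-- **Theorem 6 (general formula).** The entries of the Hessian matrices of
the Arimoto map at the capacity-achieving distribution `λ*`. -/
theorem stmt_9 (m n : ℕ) (P : Matrix (Fin m) (Fin n) ℝ)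
    (hPnn : ∀ i j, 0 ≤ P i j) (hProw : ∀ i, ∑ j, P i j = 1)
    (hPcol : ∀ j, ∃ i, 0 < P i j)
    (C : ℝ) (hub : ∀ l ∈ chSimplex m, chMI P l ≤ C)
    (lstar : Fin m → ℝ) (hls : lstar ∈ chSimplex m) (hach : chMI P lstar = C)
    (hQpos : ∀ j, 0 < chOut P lstar j)
    (Dst : Fin m → ℝ) (hDst : ∀ i, Dst i = chKL (P i) (chOut P lstar))
    (D2 : Fin m → Fin m → ℝ)
    (hD2 : ∀ i' i, D2 i' i = -∑ j, P i' j * P i j / chOut P lstar j)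
    (D3 : Fin m → Fin m → Fin m → ℝ)
    (hD3 : ∀ i i' i'', D3 i i' i''
      = chPd2 (fun x => chKL (P i) (chOut P x)) i' i'' lstar)
    (i i' i'' : Fin m) :
    chPd2 (fun x => chAF P x i) i' i'' lstar
      = Real.exp (Dst i - C)
          * ((1 - Real.exp (Dst i' - C) + D2 i i')
                * ((if i = i'' then (1 : ℝ) else 0)
                    + lstar i * (1 - Real.exp (Dst i'' - C)))
             + (1 - Real.exp (Dst i'' - C) + D2 i i'')
                * ((if i = i' then (1 : ℝ) else 0)
                    + lstar i * (1 - Real.exp (Dst i' - C)))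
             + lstar i
                * (D2 i i' * D2 i i'' + D3 i i' i'' + D2 i' i''
                    - Real.exp (Dst i' - C) * D2 i' i''
                    - Real.exp (Dst i'' - C) * D2 i' i''
                    - ∑ k ∈ Finset.univ.filter (fun k => 0 < lstar k),
                        lstar k * D2 k i' * D2 k i'')) := by
  have hKT : ∀ k, lstar k * Real.exp (chKL (P k) (chOut P lstar)) = lstar k * Real.exp C := by
    intro k
    rcases (hls.1 k).eq_or_lt with h | h
    · simp [← h]
    · rw [chKL_eq_capacity P hProw hub hls hach hQpos h]
  have hZ : ∑ k, chW P k lstar = Real.exp C := by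
    simp only [chW, hKT, ← Finset.sum_mul, hls.2, one_mul]
  have hD2' : ∀ k a, D2 k a = chKLd P k a lstar := hD2
  have hZd : ∀ a, ∑ k, chWd P k a lstar = Real.exp (Dst a) - Real.exp C := by
    intro a
    have h : ∀ k, chWd P k a lstar = (if k = a then Real.exp (Dst k) else 0)
        + lstar k * chKLd P k a lstar * Real.exp C := by
      intro k
      rw [mul_right_comm, ← hKT, chWd, hDst]
      split_ifs <;> ring
    simp only [h, Finset.sum_add_distrib, ← Finset.sum_mul,
      sum_mul_chKLd P hProw a hQpos, Finset.sum_ite_eq', Finset.mem_univ, if_true]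
    ring
  have hfilter : ∑ k ∈ Finset.univ.filter (fun k => 0 < lstar k),
      lstar k * D2 k i' * D2 k i'' = ∑ k, lstar k * D2 k i' * D2 k i'' := by
    refine Finset.sum_filter_of_ne fun k _ hk => ?_
    exact (hls.1 k).lt_of_ne' fun h => hk (by simp [h])
  have hZdd : ∑ k, chWdd P k i' i'' lstar = (Real.exp (Dst i') + Real.exp (Dst i'')) * D2 i' i''
      + Real.exp C * (∑ k, lstar k * D2 k i' * D2 k i'' - D2 i' i'') := by
    have h : ∀ k, chWdd P k i' i'' lstar
        = (if k = i' then D2 k i'' * Real.exp (Dst k) else 0)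
          + (if k = i'' then D2 k i' * Real.exp (Dst k) else 0)
          + (lstar k * D2 k i' * D2 k i'' + lstar k * chKLdd P k i' i'' lstar)
            * Real.exp C := by
      intro k
      have e : (lstar k * D2 k i' * D2 k i'' + lstar k * chKLdd P k i' i'' lstar) * Real.exp C
          = (D2 k i' * D2 k i'' + chKLdd P k i' i'' lstar) * (lstar k * Real.exp C) := by ring
      rw [e, ← hKT, chWdd, hDst, hD2', hD2']
      split_ifs <;> ring
    simp only [h, Finset.sum_add_distrib, ← Finset.sum_mul, sum_mul_chKLdd P i' i'' hQpos,
      Finset.sum_ite_eq', Finset.mem_univ, if_true]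
    rw [← hD2', hD2' i'' i', chKLd_comm, ← hD2']
    ring
  rw [chPd2_chAF P i i' i'' hQpos (by rw [hZ]; exact (Real.exp_pos C).ne'), hZ, hZd, hZd, hZdd,
    hfilter, hD3, chPd2_chKL P i i' i'' hQpos, chWdd, chWd, chWd, chW, ← hDst, ← hD2', ← hD2']
  simp only [Real.exp_sub]
  have hC := (Real.exp_pos C).ne'
  split_ifs <;> field_simp <;> ring
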